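/- arXiv:2603.05920 — 2 statements merged into one kernel-verified Lean document; each statement's English description precedes it below -/
import Mathlib

section
/- Commuting-circuit rewriting of the Hadamard test (Fig. 3 of the paper): let 0 < m ≤ n, let C be a unitary matrix indexed by {0,1}^n over ℂ, and work with matrices indexed by {0,1} × {0,1}^n. For a matrix A on {0,1}^n, let Λ(A) = |0⟩⟨0| ⊗ I + |1⟩⟨1| ⊗ A denote the controlled-A operation, and let H be the 2×2 Hadamard matrix. For 1 ≤ j ≤ m define G_j = (H ⊗ C†) · Λ(Z_j ⊗ I) · (H ⊗ C). Then (i) the matrices G_j pairwise commute, and (ii) for every s ∈ {0,1}^m, (H ⊗ C†) · Λ(D_s) · (H ⊗ C) = ∏_{j : s_j = 1} G_j. -/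
open Matrix Kronecker

/-- The diagonal matrix `D_s = Z(s) ⊗ I_{n-m}` on `{0,1}^m × {0,1}^{n-m}`. -/
noncomputable def Dmat (m k : ℕ) (s : Fin m → ZMod 2) :
    Matrix ((Fin m → ZMod 2) × (Fin k → ZMod 2)) ((Fin m → ZMod 2) × (Fin k → ZMod 2)) ℂ :=
  Matrix.diagonal fun p => (-1 : ℂ) ^ (∑ j, s j * p.1 j : ZMod 2).val

/-- The diagonal matrix `Z_j ⊗ I` on `{0,1}^m × {0,1}^{n-m}`, with `(x,x)` entry
`(−1)^{x_j}`. -/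
noncomputable def Zmat (m k : ℕ) (j : Fin m) :
    Matrix ((Fin m → ZMod 2) × (Fin k → ZMod 2)) ((Fin m → ZMod 2) × (Fin k → ZMod 2)) ℂ :=
  Matrix.diagonal fun p => (-1 : ℂ) ^ (p.1 j).val

/-- The 2×2 Hadamard matrix `H = (1/√2)·[[1,1],[1,−1]]`, indexed by `{0,1} = ZMod 2`. -/
noncomputable def Hmat : Matrix (ZMod 2) (ZMod 2) ℂ :=
  fun a b => ((Real.sqrt 2 : ℂ))⁻¹ * (-1 : ℂ) ^ (a * b : ZMod 2).val

/-- The controlled-`A` operation `Λ(A) = |0⟩⟨0| ⊗ I + |1⟩⟨1| ⊗ A` on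
`{0,1} × {0,1}^n`. -/
noncomputable def ctrl {ι : Type*} [Fintype ι] [DecidableEq ι] (A : Matrix ι ι ℂ) :
    Matrix (ZMod 2 × ι) (ZMod 2 × ι) ℂ :=
  (Matrix.diagonal fun a : ZMod 2 => if a = 0 then (1 : ℂ) else 0) ⊗ₖ (1 : Matrix ι ι ℂ)
    + (Matrix.diagonal fun a : ZMod 2 => if a = 1 then (1 : ℂ) else 0) ⊗ₖ A

/-- The sign `(-1) ^ a` is multiplicative in `a : ZMod 2`. -/
theorem neg_one_pow_val_add (a b : ZMod 2) :
    (-1 : ℂ) ^ (a + b).val = (-1) ^ a.val * (-1) ^ b.val := by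
  rw [← pow_add, ZMod.val_add, neg_one_pow_eq_pow_mod_two (n := a.val + b.val)]

theorem neg_one_pow_val_sum {ι : Type*} (t : Finset ι) (f : ι → ZMod 2) :
    (-1 : ℂ) ^ (∑ i ∈ t, f i).val = ∏ i ∈ t, (-1) ^ (f i).val := by
  classical
  induction t using Finset.induction_on with
  | empty => simp
  | insert i t hi ih => rw [Finset.sum_insert hi, Finset.prod_insert hi, neg_one_pow_val_add, ih]

theorem neg_one_pow_val_dotProduct {ι : Type*} [Fintype ι] (s x : ι → ZMod 2) :
    (-1 : ℂ) ^ (∑ i, s i * x i).val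
      = ∏ i ∈ Finset.univ.filter (fun i => s i = 1), (-1) ^ (x i).val := by
  rw [← neg_one_pow_val_sum, Finset.sum_filter]
  congr 2
  refine Finset.sum_congr rfl fun i _ => ?_
  have h : ∀ a b : ZMod 2, a * b = if a = 1 then b else 0 := by decide
  exact h _ _

theorem Hmat_mul_self : Hmat * Hmat = 1 := by
  have h2 : ((Real.sqrt 2 : ℂ))⁻¹ * ((Real.sqrt 2 : ℂ))⁻¹ = 1 / 2 := by
    rw [← mul_inv, ← Complex.ofReal_mul, Real.mul_self_sqrt (by norm_num)]
    norm_num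
  have hsum : ∀ f : ZMod 2 → ℂ, ∑ c, f c = f 0 + f 1 := fun f => Fin.sum_univ_two f
  have hval : (1 : ZMod 2).val = 1 := rfl
  have hcases : ∀ a : ZMod 2, a = 0 ∨ a = 1 := by decide
  ext a b
  rw [Matrix.mul_apply, hsum]
  rcases hcases a with rfl | rfl <;> rcases hcases b with rfl | rfl <;>
    simp [Hmat, hval, h2] <;> norm_num

theorem ctrl_diagonal {ι : Type*} [Fintype ι] [DecidableEq ι] (f : ι → ℂ) :
    ctrl (Matrix.diagonal f) = Matrix.diagonal fun p => if p.1 = 0 then 1 else f p.2 := by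
  have hcases : ∀ a : ZMod 2, a = 0 ∨ a = 1 := by decide
  rw [ctrl, ← Matrix.diagonal_one, Matrix.diagonal_kronecker_diagonal,
    Matrix.diagonal_kronecker_diagonal, Matrix.diagonal_add]
  congr 1
  ext ⟨a, i⟩
  rcases hcases a with rfl | rfl <;> simp

/-- Conjugation `f ↦ V * diagonal f * W` of diagonal matrices by mutually inverse matrices. -/
def conjDiagonal {ι : Type*} [Fintype ι] [DecidableEq ι] (V W : Matrix ι ι ℂ) (hVW : V * W = 1) :
    (ι → ℂ) →* Matrix ι ι ℂ where
  toFun f := V * Matrix.diagonal f * W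
  map_one' := by rw [show Matrix.diagonal (1 : ι → ℂ) = 1 from Matrix.diagonal_one, mul_one, hVW]
  map_mul' f g := by
    have hWV : W * V = 1 := mul_eq_one_comm.mp hVW
    calc V * Matrix.diagonal (f * g) * W
        = V * (Matrix.diagonal f * 1 * Matrix.diagonal g) * W := by
          rw [mul_one, Matrix.diagonal_mul_diagonal]; rfl
      _ = V * Matrix.diagonal f * W * (V * Matrix.diagonal g * W) := by
          rw [← hWV]; simp only [mul_assoc]

/-- Commuting-circuit rewriting of the Hadamard test (Fig. 3): for `0 < m ≤ n`, a
unitary `C` on `n` qubits and `G_j = (H ⊗ C†) · Λ(Z_j ⊗ I) · (H ⊗ C)`,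
(i) the `G_j` pairwise commute, and (ii) for every `s ∈ {0,1}^m`,
`(H ⊗ C†) · Λ(D_s) · (H ⊗ C) = ∏_{j : s_j = 1} G_j`. -/
theorem hadamard_test_commuting_rewrite {n m : ℕ} (hm0 : 0 < m) (hmn : m ≤ n)
    (C : Matrix ((Fin m → ZMod 2) × (Fin (n - m) → ZMod 2))
         ((Fin m → ZMod 2) × (Fin (n - m) → ZMod 2)) ℂ)
    (hC : C ∈ Matrix.unitaryGroup ((Fin m → ZMod 2) × (Fin (n - m) → ZMod 2)) ℂ)
    (G : Fin m → Matrix (ZMod 2 × ((Fin m → ZMod 2) × (Fin (n - m) → ZMod 2)))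
         (ZMod 2 × ((Fin m → ZMod 2) × (Fin (n - m) → ZMod 2))) ℂ)
    (hG : ∀ j, G j = (Hmat ⊗ₖ Cᴴ) * ctrl (Zmat m (n - m) j) * (Hmat ⊗ₖ C)) :
    (∀ j k, Commute (G j) (G k)) ∧
    ∀ (s : Fin m → ZMod 2)
      (hcomm : ((Finset.univ.filter fun j => s j = 1 : Finset (Fin m)) : Set (Fin m)).Pairwise
        fun a b => Commute (G a) (G b)),
      (Hmat ⊗ₖ Cᴴ) * ctrl (Dmat m (n - m) s) * (Hmat ⊗ₖ C)
        = (Finset.univ.filter fun j => s j = 1).noncommProd G hcomm := by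
  have hVW : (Hmat ⊗ₖ Cᴴ) * (Hmat ⊗ₖ C) = 1 := by
    rw [← Matrix.mul_kronecker_mul, Hmat_mul_self, ← Matrix.star_eq_conjTranspose,
      Matrix.mem_unitaryGroup_iff'.mp hC, Matrix.one_kronecker_one]
  let φ := conjDiagonal _ _ hVW
  let g : Fin m → ZMod 2 × ((Fin m → ZMod 2) × (Fin (n - m) → ZMod 2)) → ℂ :=
    fun j p => if p.1 = 0 then 1 else (-1) ^ (p.2.1 j).val
  obtain rfl : G = fun j => φ (g j) := funext fun j => by
    rw [hG, Zmat, ctrl_diagonal]; rfl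
  refine ⟨fun j k => (Commute.all (g j) (g k)).map φ, fun s hcomm => ?_⟩
  rw [← Finset.map_noncommProd _ g (fun _ _ _ _ _ => Commute.all _ _) φ,
    Finset.noncommProd_eq_prod, Dmat, ctrl_diagonal]
  change φ _ = φ _
  congr 1
  ext p
  rw [Finset.prod_apply, neg_one_pow_val_dotProduct]
  by_cases hp : p.1 = 0 <;> simp [hp]
end

section
/- Deterministic error bound underlying Lemma 3.4 of the paper: let m ≥ 1 and let p, q_L be real numbers with p ≥ 1 and q_L ≥ 1; set θ = 3·p·q_L, q = 24·p·θ², and r = 12·p·θ², and assume r > 1. Let L̃ ⊆ L be finite subsets of {0,1}^m, and let ĝ, V, A, B : {0,1}^m → ℝ satisfy: |ĝ(s)| ≤ 1 for all s ∈ L; |V(s)| ≤ 1 for all s ∈ L; |ĝ(s)| < 1/θ for all s ∈ L \ L̃; |L| ≤ q_L; |L̃| < 4θ²; and for all s ∈ L̃, |ĝ(s) − A(s)| ≤ 1/q and |V(s) − B(s)| ≤ 1/r. Then |Σ_{s ∈ L} ĝ(s)·V(s) − Σ_{s ∈ L̃} A(s)·B(s)| < 1/p. -/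
/-- Perturbing both factors of a product `g * v` with `|g| ≤ 1` and `|v| ≤ 1`. -/
theorem abs_mul_sub_mul_le_of_abs_le_one {g v a b ε δ : ℝ} (hg : |g| ≤ 1) (hv : |v| ≤ 1)
    (hδ : δ ≤ 1) (ha : |g - a| ≤ ε) (hb : |v - b| ≤ δ) :
    |g * v - a * b| ≤ δ + 2 * ε := by
  have hb2 : |b| ≤ 2 := by
    rw [abs_le] at *
    constructor <;> linarith
  calc |g * v - a * b| = |g * (v - b) + (g - a) * b| := by ring_nf
    _ ≤ |g| * |v - b| + |g - a| * |b| := by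
      simpa only [abs_mul] using abs_add_le (g * (v - b)) ((g - a) * b)
    _ ≤ 1 * δ + ε * 2 := by
      have := (abs_nonneg _).trans ha
      gcongr
    _ = δ + 2 * ε := by ring

/-- Deterministic error bound underlying Lemma 3.4: with `p, q_L ≥ 1`,
`θ = 3·p·q_L`, `q = 24·p·θ²`, `r = 12·p·θ²`, `r > 1`, finite sets `L̃ ⊆ L` of
`m`-bit strings, and `gHat, V, A, B` satisfying the listed bounds, one has
`|Σ_{s ∈ L} gHat(s)·V(s) − Σ_{s ∈ L̃} A(s)·B(s)| < 1/p`. -/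
theorem deterministic_error_bound {m : ℕ} (hm : 1 ≤ m)
    (p qL : ℝ) (hp : 1 ≤ p) (hqL : 1 ≤ qL)
    (θ q r : ℝ) (hθ : θ = 3 * p * qL) (hq : q = 24 * p * θ ^ 2) (hr : r = 12 * p * θ ^ 2)
    (hr1 : 1 < r)
    (L Lt : Finset (Fin m → ZMod 2)) (hsub : Lt ⊆ L)
    (gHat V A B : (Fin m → ZMod 2) → ℝ)
    (hg1 : ∀ s ∈ L, |gHat s| ≤ 1)
    (hV1 : ∀ s ∈ L, |V s| ≤ 1)
    (hsmall : ∀ s ∈ L \ Lt, |gHat s| < 1 / θ)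
    (hL : (L.card : ℝ) ≤ qL)
    (hLt : (Lt.card : ℝ) < 4 * θ ^ 2)
    (hA : ∀ s ∈ Lt, |gHat s - A s| ≤ 1 / q)
    (hB : ∀ s ∈ Lt, |V s - B s| ≤ 1 / r) :
    |∑ s ∈ L, gHat s * V s - ∑ s ∈ Lt, A s * B s| < 1 / p := by
  have hθ0 : 0 < θ := by rw [hθ]; positivity
  have hlarge : |∑ s ∈ Lt, (gHat s * V s - A s * B s)| < 2 / (3 * p) := by
    calc |∑ s ∈ Lt, (gHat s * V s - A s * B s)|
        ≤ ∑ s ∈ Lt, |gHat s * V s - A s * B s| := Finset.abs_sum_le_sum_abs _ _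
      _ ≤ Lt.card • (1 / r + 2 * (1 / q)) := Finset.sum_le_card_nsmul _ _ _ fun s hs =>
          abs_mul_sub_mul_le_of_abs_le_one (hg1 s (hsub hs)) (hV1 s (hsub hs))
            ((div_le_one (by linarith)).2 hr1.le) (hA s hs) (hB s hs)
      _ = Lt.card * (1 / (6 * p * θ ^ 2)) := by
          rw [nsmul_eq_mul, hr, hq]
          field_simp
          ring
      _ < 4 * θ ^ 2 * (1 / (6 * p * θ ^ 2)) := by gcongr
      _ = 2 / (3 * p) := by
          field_simp
          norm_num
  have hrest : |∑ s ∈ L \ Lt, gHat s * V s| ≤ 1 / (3 * p) := by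
    calc |∑ s ∈ L \ Lt, gHat s * V s|
        ≤ ∑ s ∈ L \ Lt, |gHat s * V s| := Finset.abs_sum_le_sum_abs _ _
      _ ≤ (L \ Lt).card • (1 / θ) := by
          refine Finset.sum_le_card_nsmul _ _ _ fun s hs => ?_
          rw [abs_mul]
          exact (mul_le_of_le_one_right (abs_nonneg _)
            (hV1 s (Finset.sdiff_subset hs))).trans (hsmall s hs).le
      _ ≤ qL * (1 / θ) := by
          rw [nsmul_eq_mul]
          have : ((L \ Lt).card : ℝ) ≤ L.card := by
            exact_mod_cast Finset.card_le_card Finset.sdiff_subset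
          gcongr
          exact this.trans hL
      _ = 1 / (3 * p) := by
          rw [hθ]
          field_simp
  calc |∑ s ∈ L, gHat s * V s - ∑ s ∈ Lt, A s * B s|
      = |∑ s ∈ L \ Lt, gHat s * V s + ∑ s ∈ Lt, (gHat s * V s - A s * B s)| := by
        rw [← Finset.sum_sdiff hsub, Finset.sum_sub_distrib, add_sub_assoc]
    _ ≤ |∑ s ∈ L \ Lt, gHat s * V s| + |∑ s ∈ Lt, (gHat s * V s - A s * B s)| :=
        abs_add_le _ _
    _ < 1 / (3 * p) + 2 / (3 * p) := add_lt_add_of_le_of_lt hrest hlarge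
    _ = 1 / p := by
        field_simp
        norm_num
end
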